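/- arXiv:2601.08893 — 3 statements merged into one kernel-verified Lean document; each statement's English description precedes it below -/
import Mathlib

section
/- Let d ≥ 1 and ν > 0. Let u : ℝ × ℝᵈ → ℝᵈ, p : ℝ × ℝᵈ → ℝ, and f : ℝ × ℝᵈ → ℝᵈ be smooth, suppose there is a compact set K ⊆ ℝᵈ such that u(t, ·) vanishes outside K for every t, suppose div u(t, ·) = 0 for every t, and suppose u solves the Navier–Stokes equations ∂ₜu + (u·∇)u = −∇p + νΔu + f. Then for every t, the function E(t) = ½ ∫_{ℝᵈ} ‖u(t,x)‖² dx is differentiable with E′(t) = −ν ∫_{ℝᵈ} Σᵢⱼ (∂ᵢuⱼ(t,x))² dx + ∫_{ℝᵈ} ⟪f(t,x), u(t,x)⟫ dx. -/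
open MeasureTheory RealInnerProductSpace

/-- Divergence of a vector field on `ℝᵈ`: `div u x = ∑ i, ∂ᵢ uᵢ (x)`. -/
noncomputable def ediv (d : ℕ)
    (u : EuclideanSpace ℝ (Fin d) → EuclideanSpace ℝ (Fin d))
    (x : EuclideanSpace ℝ (Fin d)) : ℝ :=
  ∑ i, fderiv ℝ u x (EuclideanSpace.single i 1) i

/-- Componentwise Laplacian of a vector field on `ℝᵈ`: `Δv x = ∑ i, ∂ᵢ∂ᵢ v (x)`. -/
noncomputable def elap (d : ℕ)
    (v : EuclideanSpace ℝ (Fin d) → EuclideanSpace ℝ (Fin d))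
    (x : EuclideanSpace ℝ (Fin d)) : EuclideanSpace ℝ (Fin d) :=
  ∑ i, fderiv ℝ (fun y => fderiv ℝ v y (EuclideanSpace.single i 1)) x
    (EuclideanSpace.single i 1)

theorem integral_fderiv_apply_eq_zero {E : Type*} [NormedAddCommGroup E] [NormedSpace ℝ E]
    [MeasurableSpace E] [BorelSpace E] [FiniteDimensional ℝ E] (μ : Measure E)
    [μ.IsAddHaarMeasure] {g : E → ℝ} (hg : ContDiff ℝ 1 g) (hc : HasCompactSupport g) (v : E) :
    ∫ x, fderiv ℝ g x v ∂μ = 0 := by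
  have hcont : Continuous fun x => fderiv ℝ g x v :=
    (hg.continuous_fderiv (by norm_num)).clm_apply continuous_const
  have hint : Integrable (fun x => fderiv ℝ g x v) μ :=
    hcont.integrable_of_hasCompactSupport (hc.fderiv_apply (𝕜 := ℝ) v)
  have h := integral_mul_fderiv_eq_neg_fderiv_mul_of_integrable (𝕜 := ℝ) (μ := μ) (f := g)
    (g := fun _ => (1 : ℝ)) (v := v) (by simpa using hint) (by simp)
    (by simpa using hg.continuous.integrable_of_hasCompactSupport hc)
    (fun x _ => hg.differentiable (by norm_num) x) (fun _ _ => differentiableAt_const _)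
  simpa using h.symm

theorem hasDerivAt_integral_of_contDiff_of_forall_notMem_eq_zero {E : Type*}
    [NormedAddCommGroup E] [NormedSpace ℝ E] [MeasurableSpace E] [BorelSpace E]
    (μ : Measure E) [IsFiniteMeasureOnCompacts μ] {G : ℝ → E → ℝ}
    (hG : ContDiff ℝ 1 (Function.uncurry G)) {K : Set E} (hK : IsCompact K)
    (hGK : ∀ t x, x ∉ K → G t x = 0) (t : ℝ) :
    HasDerivAt (fun τ => ∫ x, G τ x ∂μ) (∫ x, deriv (fun s => G s x) t ∂μ) t := by
  have hder : ∀ s x, HasDerivAt (fun r => G r x)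
      (fderiv ℝ (Function.uncurry G) (s, x) (1, 0)) s := by
    intro s x
    have h := (hG.differentiable (by norm_num) (s, x)).hasFDerivAt
    exact h.comp_hasDerivAt_of_eq s ((hasDerivAt_id' s).prodMk (hasDerivAt_const s x)) rfl
  have hcont : Continuous fun z : ℝ × E => fderiv ℝ (Function.uncurry G) z (1, 0) :=
    (hG.continuous_fderiv (by norm_num)).clm_apply continuous_const
  have hGc : ∀ s, Continuous (G s) := fun s =>
    hG.continuous.comp (continuous_const.prodMk continuous_id)
  have hcs : ∀ s, HasCompactSupport (G s) := fun s => HasCompactSupport.intro hK (hGK s)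
  obtain ⟨C, hC⟩ := ((isCompact_closedBall t 1).prod hK).exists_bound_of_continuousOn
    hcont.continuousOn
  have hzero : ∀ s x, x ∉ K → fderiv ℝ (Function.uncurry G) (s, x) (1, 0) = 0 := by
    intro s x hx
    rw [← (hder s x).deriv]
    simp [hGK _ x hx]
  have hdcont : Continuous fun x => fderiv ℝ (Function.uncurry G) (t, x) (1, 0) :=
    hcont.comp (continuous_const.prodMk continuous_id)
  have key := hasDerivAt_integral_of_dominated_loc_of_deriv_le (μ := μ) (F := G)
    (F' := fun s x => fderiv ℝ (Function.uncurry G) (s, x) (1, 0))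
    (bound := K.indicator fun _ => C) (Metric.closedBall_mem_nhds t one_pos)
    (.of_forall fun s =>
      ((hGc s).integrable_of_hasCompactSupport (hcs s)).aestronglyMeasurable)
    ((hGc t).integrable_of_hasCompactSupport (hcs t))
    (hdcont.integrable_of_hasCompactSupport
      (HasCompactSupport.intro hK (hzero t))).aestronglyMeasurable
    (.of_forall fun x s hs => by
      by_cases hx : x ∈ K
      · simpa [hx] using hC (s, x) ⟨hs, hx⟩
      · simp [hx, hzero s x hx])
    ((integrable_indicator_iff hK.measurableSet).2
      (integrableOn_const hK.measure_lt_top.ne))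
    (.of_forall fun x s _ => hder s x)
  simpa only [(hder t _).deriv] using key.2

/-- The `i`-th component of the spatial energy flux of a velocity `v` with pressure `q`. -/
noncomputable def energyFlux (d : ℕ) (ν : ℝ)
    (v : EuclideanSpace ℝ (Fin d) → EuclideanSpace ℝ (Fin d))
    (q : EuclideanSpace ℝ (Fin d) → ℝ) (i : Fin d) (x : EuclideanSpace ℝ (Fin d)) : ℝ :=
  ν * ⟪fderiv ℝ v x (EuclideanSpace.single i 1), v x⟫ - ((1 / 2) * ⟪v x, v x⟫ + q x) * v x i

section EnergyFlux

variable {d : ℕ} {ν : ℝ} {v : EuclideanSpace ℝ (Fin d) → EuclideanSpace ℝ (Fin d)}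
  {q : EuclideanSpace ℝ (Fin d) → ℝ}

theorem contDiff_energyFlux (hv : ContDiff ℝ 2 v) (hq : ContDiff ℝ 1 q) (i : Fin d) :
    ContDiff ℝ 1 (energyFlux d ν v q i) := by
  have h1 : ContDiff ℝ 1 v := hv.of_le (by norm_num)
  have h2 : ContDiff ℝ 1 fun x => fderiv ℝ v x (EuclideanSpace.single i 1) :=
    (hv.fderiv_right (by norm_num)).clm_apply contDiff_const
  have h3 : ContDiff ℝ 1 fun x => v x i := contDiff_euclidean.1 h1 i
  exact (contDiff_const.mul (h2.inner ℝ h1)).sub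
    (((contDiff_const.mul (h1.inner ℝ h1)).add hq).mul h3)

theorem fderiv_energyFlux_apply (hv : ContDiff ℝ 2 v) (hq : ContDiff ℝ 1 q) (i : Fin d)
    (x w : EuclideanSpace ℝ (Fin d)) :
    fderiv ℝ (energyFlux d ν v q i) x w =
      ν * (⟪fderiv ℝ v x (EuclideanSpace.single i 1), fderiv ℝ v x w⟫
        + ⟪fderiv ℝ (fun y => fderiv ℝ v y (EuclideanSpace.single i 1)) x w, v x⟫)
      - (⟪fderiv ℝ v x w, v x⟫ + fderiv ℝ q x w) * v x i
      - ((1 / 2) * ⟪v x, v x⟫ + q x) * fderiv ℝ v x w i := by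
  have h1 := (hv.differentiable (by norm_num) x).hasFDerivAt
  have h2 : HasFDerivAt (fun y => fderiv ℝ v y (EuclideanSpace.single i 1)) _ x :=
    (((hv.fderiv_right (m := 1) (by norm_num)).clm_apply
      contDiff_const).differentiable (by norm_num) x).hasFDerivAt
  have h3 : HasFDerivAt (fun y => v y i) _ x :=
    (EuclideanSpace.proj i : EuclideanSpace ℝ (Fin d) →L[ℝ] ℝ).hasFDerivAt.comp x h1
  have h4 := (hq.differentiable (by norm_num) x).hasFDerivAt
  have h : HasFDerivAt (energyFlux d ν v q i) _ x := ((h2.inner ℝ h1).const_mul ν).sub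
    ((((h1.inner ℝ h1).const_mul (1 / 2)).add h4).mul h3)
  rw [h.fderiv]
  simp [fderivInnerCLM_apply, real_inner_comm (v x)]
  ring

theorem sum_fderiv_energyFlux (hv : ContDiff ℝ 2 v) (hq : ContDiff ℝ 1 q)
    (hdiv : ∀ x, ediv d v x = 0) (x : EuclideanSpace ℝ (Fin d)) :
    ∑ i, fderiv ℝ (energyFlux d ν v q i) x (EuclideanSpace.single i 1) =
      ν * ∑ i, ∑ j, (fderiv ℝ v x (EuclideanSpace.single i 1) j) ^ 2
        + ν * ⟪elap d v x, v x⟫ - ⟪fderiv ℝ v x (v x), v x⟫ - ⟪gradient q x, v x⟫ := by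
  have hsum : v x = ∑ i, v x i • EuclideanSpace.single i (1 : ℝ) := by
    simpa using ((EuclideanSpace.basisFun (Fin d) ℝ).sum_repr (v x)).symm
  have hlin : ∀ {F : Type} [NormedAddCommGroup F] [NormedSpace ℝ F]
      (L : EuclideanSpace ℝ (Fin d) →L[ℝ] F),
      L (v x) = ∑ i, v x i • L (EuclideanSpace.single i 1) := by
    intro F _ _ L
    conv_lhs => rw [hsum]
    simp only [map_sum, map_smul]
  have hgrad : ⟪gradient q x, v x⟫ = fderiv ℝ q x (v x) := by
    simp [gradient, InnerProductSpace.toDual_symm_apply]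
  have hd := hdiv x
  rw [ediv] at hd
  rw [hgrad, hlin (fderiv ℝ v x), hlin (fderiv ℝ q x), elap, sum_inner, sum_inner]
  simp only [fderiv_energyFlux_apply hv hq, Finset.sum_sub_distrib, ← Finset.mul_sum, hd,
    mul_zero, Finset.sum_add_distrib, add_mul, inner_smul_left, smul_eq_mul]
  simp only [real_inner_self_eq_norm_sq, EuclideanSpace.real_norm_sq_eq, conj_trivial, mul_comm]
  ring

theorem integral_sum_fderiv_energyFlux (hv : ContDiff ℝ 2 v) (hq : ContDiff ℝ 1 q)
    (hc : HasCompactSupport v) :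
    Integrable (fun x => ∑ i, fderiv ℝ (energyFlux d ν v q i) x (EuclideanSpace.single i 1)) ∧
    ∫ x, ∑ i, fderiv ℝ (energyFlux d ν v q i) x (EuclideanSpace.single i 1) = 0 := by
  have hcs : ∀ i, HasCompactSupport (energyFlux d ν v q i) := fun i =>
    hc.mono fun x hx h => hx (by simp [energyFlux, h])
  have hint : ∀ i, Integrable fun x =>
      fderiv ℝ (energyFlux d ν v q i) x (EuclideanSpace.single i 1) := fun i =>
    (((contDiff_energyFlux hv hq i).continuous_fderiv (by norm_num)).clm_apply
      continuous_const).integrable_of_hasCompactSupport ((hcs i).fderiv_apply (𝕜 := ℝ) _)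
  refine ⟨integrable_finsetSum _ fun i _ => hint i, ?_⟩
  rw [integral_finsetSum _ fun i _ => hint i]
  exact Finset.sum_eq_zero fun i _ =>
    integral_fderiv_apply_eq_zero _ (contDiff_energyFlux hv hq i) (hcs i) _

end EnergyFlux

theorem stmt_6 (d : ℕ) (hd : 1 ≤ d) (ν : ℝ) (hν : 0 < ν)
    (u f : ℝ → EuclideanSpace ℝ (Fin d) → EuclideanSpace ℝ (Fin d))
    (p : ℝ → EuclideanSpace ℝ (Fin d) → ℝ)
    (hu : ContDiff ℝ (⊤ : ℕ∞) (Function.uncurry u))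
    (hp : ContDiff ℝ (⊤ : ℕ∞) (Function.uncurry p))
    (hf : ContDiff ℝ (⊤ : ℕ∞) (Function.uncurry f))
    (K : Set (EuclideanSpace ℝ (Fin d))) (hK : IsCompact K)
    (hKsupp : ∀ t x, x ∉ K → u t x = 0)
    (hdiv : ∀ t x, ediv d (u t) x = 0)
    (hNS : ∀ t x, deriv (fun s => u s x) t + fderiv ℝ (u t) x (u t x)
      = -gradient (p t) x + ν • elap d (u t) x + f t x) :
    ∀ t, HasDerivAt (fun τ => (1 / 2 : ℝ) * ∫ x, ‖u τ x‖ ^ 2)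
      (-ν * (∫ x, ∑ i, ∑ j, (fderiv ℝ (u t) x (EuclideanSpace.single i 1) j) ^ 2)
        + ∫ x, ⟪f t x, u t x⟫) t := by
  intro t
  have hslice : ∀ x, DifferentiableAt ℝ (fun s => u s x) t := fun x =>
    (hu.comp (contDiff_id.prodMk contDiff_const)).differentiable (by simp) t
  have hv : ContDiff ℝ 2 (u t) :=
    (hu.comp (contDiff_const.prodMk contDiff_id)).of_le
      (WithTop.coe_le_coe.2 (le_top : (2 : ℕ∞) ≤ ⊤))
  have hq : ContDiff ℝ 1 (p t) :=
    (hp.comp (contDiff_const.prodMk contDiff_id)).of_le (by exact_mod_cast le_top)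
  have hft : Continuous (f t) := hf.continuous.comp (continuous_const.prodMk continuous_id)
  have hc : HasCompactSupport (u t) := HasCompactSupport.intro hK (hKsupp t)
  have hG : ContDiff ℝ 1 (Function.uncurry fun s x => ‖u s x‖ ^ 2) :=
    (hu.of_le (by exact_mod_cast le_top)).norm_sq ℝ
  have hE := (hasDerivAt_integral_of_contDiff_of_forall_notMem_eq_zero volume hG hK
    (fun s x hx => by simp [hKsupp s x hx]) t).const_mul (1 / 2)
  obtain ⟨hflux, hflux0⟩ := integral_sum_fderiv_energyFlux (ν := ν) hv hq hc
  have hD : Integrable fun x =>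
      ∑ i, ∑ j, (fderiv ℝ (u t) x (EuclideanSpace.single i 1) j) ^ 2 := by
    refine Continuous.integrable_of_hasCompactSupport ?_ ?_
    · have := hv.continuous_fderiv (by norm_num)
      fun_prop
    · exact (hc.fderiv ℝ).mono fun x hx h => hx (by simp [h])
  have hI : Integrable fun x => ⟪f t x, u t x⟫ :=
    (hft.inner hv.continuous).integrable_of_hasCompactSupport
      (hc.mono fun x hx h => hx (by simp [h]))
  have hpt : ∀ x, (1 / 2 : ℝ) * deriv (fun s => ‖u s x‖ ^ 2) t =
      ∑ i, fderiv ℝ (energyFlux d ν (u t) (p t) i) x (EuclideanSpace.single i 1)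
        - ν * (∑ i, ∑ j, (fderiv ℝ (u t) x (EuclideanSpace.single i 1) j) ^ 2)
        + ⟪f t x, u t x⟫ := by
    intro x
    have h := congrArg (fun w => ⟪w, u t x⟫) (hNS t x)
    simp only [inner_add_left, inner_neg_left, real_inner_smul_left] at h
    rw [(hslice x).hasDerivAt.norm_sq.deriv, real_inner_comm,
      sum_fderiv_energyFlux hv hq (hdiv t)]
    linarith
  rw [← integral_const_mul] at hE
  simp only [hpt] at hE
  have hsub := hflux.sub (hD.const_mul ν)
  simp only [Pi.sub_def] at hsub
  rw [integral_add hsub hI, integral_sub hflux (hD.const_mul ν),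
    hflux0, integral_const_mul, zero_sub, ← neg_mul] at hE
  exact hE
end

section
/- Let d ≥ 1, ν > 0, and C ≥ 0. Let u : ℝ × ℝᵈ → ℝᵈ, p : ℝ × ℝᵈ → ℝ, and f : ℝ × ℝᵈ → ℝᵈ be smooth, suppose there is a compact set K ⊆ ℝᵈ such that u(t, ·) vanishes outside K for every t, suppose div u(t, ·) = 0 for every t, suppose u solves ∂ₜu + (u·∇)u = −∇p + νΔu + f, and suppose 2 ∫_{ℝᵈ} ⟪f(s,x), u(s,x)⟫ dx ≤ C for all s ≥ 0. Then for every t ≥ 0, ∫_{ℝᵈ} ‖u(t,x)‖² dx + 2ν ∫₀ᵗ ∫_{ℝᵈ} Σᵢⱼ (∂ᵢuⱼ(s,x))² dx ds ≤ ∫_{ℝᵈ} ‖u(0,x)‖² dx + C t. -/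
open MeasureTheory RealInnerProductSpace

section CompactSupport

variable {E : Type*} [NormedAddCommGroup E] [InnerProductSpace ℝ E] [FiniteDimensional ℝ E]
  [MeasurableSpace E] [BorelSpace E]

/-- The integral of a directional derivative of a compactly supported function vanishes. -/
theorem integral_fderiv_apply_eq_zero_of_hasCompactSupport {g : E → ℝ} (hg : ContDiff ℝ 1 g)
    (hs : HasCompactSupport g) (v : E) : ∫ x, fderiv ℝ g x v = 0 := by
  have hc : Continuous fun x => fderiv ℝ g x v :=
    (hg.continuous_fderiv one_ne_zero).clm_apply continuous_const
  have h := integral_mul_fderiv_eq_neg_fderiv_mul_of_integrable (μ := volume)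
    (f := fun _ : E => (1 : ℝ)) (g := g) (v := v) (by simp)
    (by simpa using hc.integrable_of_hasCompactSupport (hs.fderiv_apply ℝ v))
    (by simpa using hg.continuous.integrable_of_hasCompactSupport hs)
    (fun x _ => by fun_prop) (fun x _ => hg.differentiable one_ne_zero x)
  simpa using h

/-- Differentiation under the integral sign for functions supported in a fixed compact set. -/
theorem hasDerivAt_integral_of_support_subset {F F' : ℝ → E → ℝ} {K : Set E} (hK : IsCompact K)
    (hF : Continuous (Function.uncurry F)) (hF' : Continuous (Function.uncurry F'))
    (hderiv : ∀ t x, HasDerivAt (fun s => F s x) (F' t x) t)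
    (hsupp : ∀ t x, x ∉ K → F t x = 0) (t : ℝ) :
    HasDerivAt (fun s => ∫ x, F s x) (∫ x, F' t x) t := by
  have hsupp' : ∀ t x, x ∉ K → F' t x = 0 := fun t x hx => by
    have h := hderiv t x
    simp only [hsupp _ x hx] at h
    exact h.unique (hasDerivAt_const t 0)
  obtain ⟨M, hM⟩ := ((isCompact_Icc (a := t - 1) (b := t + 1)).prod hK).exists_bound_of_continuousOn
    hF'.continuousOn
  have hbound : Integrable (K.indicator fun _ => M) :=
    (integrable_indicator_iff hK.measurableSet).2 (integrableOn_const hK.measure_ne_top)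
  refine (hasDerivAt_integral_of_dominated_loc_of_deriv_le (F' := F')
    (Icc_mem_nhds (by linarith : t - 1 < t) (by linarith : t < t + 1))
    (.of_forall fun s => (hF.uncurry_left s).aestronglyMeasurable)
    ((hF.uncurry_left t).integrable_of_hasCompactSupport (.intro hK fun x hx => hsupp t x hx))
    (hF'.uncurry_left t).aestronglyMeasurable
    (.of_forall fun x s hs => ?_) hbound (.of_forall fun x s _ => hderiv s x)).2
  by_cases hx : x ∈ K
  · simpa [hx] using hM (s, x) ⟨hs, hx⟩
  · simp [hx, hsupp' s x hx]

/-- Continuity of integrals of functions supported in a fixed compact set. -/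
theorem continuous_integral_of_support_subset {F : ℝ → E → ℝ} {K : Set E} (hK : IsCompact K)
    (hF : Continuous (Function.uncurry F)) (hsupp : ∀ t x, x ∉ K → F t x = 0) :
    Continuous fun s => ∫ x, F s x := by
  rw [← continuousOn_univ]
  exact continuousOn_integral_of_compact_support hK hF.continuousOn fun t x _ => hsupp t x

end CompactSupport

section Euclidean

variable {d : ℕ}

local notation "E" => EuclideanSpace ℝ (Fin d)

/-- The integral of the divergence of a compactly supported vector field vanishes. -/
theorem integral_ediv_eq_zero {w : E → E} (hw : ContDiff ℝ 1 w) (hs : HasCompactSupport w) :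
    ∫ x, ediv d w x = 0 := by
  have hcoord : ∀ i : Fin d, ContDiff ℝ 1 fun x => w x i := fun i => by fun_prop
  have hsc : ∀ i : Fin d, HasCompactSupport fun x => w x i := fun i =>
    hs.comp_left (g := fun y : E => y i) rfl
  have hfd : ∀ (i : Fin d) (x v : E), fderiv ℝ w x v i = fderiv ℝ (fun y => w y i) x v := by
    intro i x v
    have h := ((EuclideanSpace.proj (𝕜 := ℝ) i : E →L[ℝ] ℝ).hasFDerivAt.comp x
      (hw.differentiable one_ne_zero x).hasFDerivAt).fderiv
    exact (DFunLike.congr_fun h v).symm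
  simp only [ediv, hfd]
  rw [integral_finsetSum]
  · exact Finset.sum_eq_zero fun i _ =>
      integral_fderiv_apply_eq_zero_of_hasCompactSupport (hcoord i) (hsc i) _
  · intro i _
    exact (((hcoord i).continuous_fderiv one_ne_zero).clm_apply
      continuous_const).integrable_of_hasCompactSupport ((hsc i).fderiv_apply ℝ _)

theorem ediv_smul {g : E → ℝ} {w : E → E} {x : E} (hg : DifferentiableAt ℝ g x)
    (hw : DifferentiableAt ℝ w x) :
    ediv d (fun y => g y • w y) x = g x * ediv d w x + fderiv ℝ g x (w x) := by
  have hsum : w x = ∑ i, w x i • EuclideanSpace.single i (1 : ℝ) := by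
    ext j
    simp [Finset.sum_apply, Pi.single_apply]
  conv_rhs => rw [hsum, map_sum]
  simp only [ediv, fderiv_fun_smul hg hw, Finset.mul_sum, ← Finset.sum_add_distrib]
  refine Finset.sum_congr rfl fun i _ => ?_
  simp [mul_comm]

/-- A compactly supported divergence-free field is orthogonal to gradients in `L²`. -/
theorem integral_fderiv_apply_self_eq_zero {g : E → ℝ} {w : E → E} (hg : ContDiff ℝ 1 g)
    (hw : ContDiff ℝ 1 w) (hs : HasCompactSupport w) (hdiv : ∀ x, ediv d w x = 0) :
    ∫ x, fderiv ℝ g x (w x) = 0 := by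
  rw [← integral_ediv_eq_zero (hg.smul hw) hs.smul_left]
  refine integral_congr_ae (.of_forall fun x => ?_)
  have h := ediv_smul (hg.differentiable one_ne_zero x) (hw.differentiable one_ne_zero x)
  simp only [hdiv x, mul_zero, zero_add] at h
  exact h.symm

/-- Trilinear cancellation `⟪(w·∇)w, w⟫ = 0` in `L²` for divergence-free `w`. -/
theorem integral_inner_fderiv_self_eq_zero {w : E → E} (hw : ContDiff ℝ 1 w)
    (hs : HasCompactSupport w) (hdiv : ∀ x, ediv d w x = 0) :
    ∫ x, ⟪fderiv ℝ w x (w x), w x⟫ = 0 := by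
  have h := integral_fderiv_apply_self_eq_zero (hw.inner ℝ hw) hw hs hdiv
  have hpt : ∀ x, fderiv ℝ (fun y => ⟪w y, w y⟫) x (w x) = 2 * ⟪fderiv ℝ w x (w x), w x⟫ := by
    intro x
    have hx := hw.differentiable one_ne_zero x
    rw [fderiv_inner_apply ℝ hx hx, real_inner_comm]
    ring
  simp only [hpt, integral_const_mul] at h
  linarith

theorem sum_sq_fderiv_eq (w : E → E) (x : E) :
    ∑ i, ∑ j, (fderiv ℝ w x (EuclideanSpace.single i 1) j) ^ 2
      = ∑ i, ‖fderiv ℝ w x (EuclideanSpace.single i 1)‖ ^ 2 := by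
  simp [EuclideanSpace.norm_sq_eq]

/-- Green's identity `∫ ⟪Δw, w⟫ = -∫ |∇w|²` for compactly supported vector fields. -/
theorem integral_inner_elap_self {w : E → E} (hw : ContDiff ℝ 2 w) (hs : HasCompactSupport w) :
    ∫ x, ⟪elap d w x, w x⟫
      = -∫ x, ∑ i, ∑ j, (fderiv ℝ w x (EuclideanSpace.single i 1) j) ^ 2 := by
  simp only [sum_sq_fderiv_eq]
  have hw1 : ContDiff ℝ 1 w := hw.of_le one_le_two
  have hd1 : ∀ v : E, ContDiff ℝ 1 fun x => fderiv ℝ w x v := fun v =>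
    (hw.fderiv_right (m := 1) (by norm_num)).clm_apply contDiff_const
  have hd2 : ∀ v : E, Continuous fun x => fderiv ℝ (fun y => fderiv ℝ w y v) x v := fun v =>
    ((hd1 v).continuous_fderiv one_ne_zero).clm_apply continuous_const
  have hsd : ∀ v : E, HasCompactSupport fun x => fderiv ℝ w x v := fun v => hs.fderiv_apply ℝ v
  have hi1 : ∀ v : E, Integrable fun x => ⟪fderiv ℝ (fun y => fderiv ℝ w y v) x v, w x⟫ := fun v =>
    ((hd2 v).inner hw.continuous).integrable_of_hasCompactSupport
      (hs.mono fun x hx h => hx (by simp [h]))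
  have hi2 : ∀ v : E, Integrable fun x => ‖fderiv ℝ w x v‖ ^ 2 := fun v =>
    ((hd1 v).continuous.norm.pow 2).integrable_of_hasCompactSupport
      ((hsd v).mono fun x hx h => hx (by simp [h]))
  have key : ∀ v : E, ∫ x, ⟪fderiv ℝ (fun y => fderiv ℝ w y v) x v, w x⟫
      = -∫ x, ‖fderiv ℝ w x v‖ ^ 2 := by
    intro v
    have h := integral_fderiv_apply_eq_zero_of_hasCompactSupport ((hd1 v).inner ℝ hw1)
      (hs.mono fun x hx h => hx (by simp [h])) v
    have hpt : ∀ x, fderiv ℝ (fun y => ⟪fderiv ℝ w y v, w y⟫) x v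
        = ‖fderiv ℝ w x v‖ ^ 2 + ⟪fderiv ℝ (fun y => fderiv ℝ w y v) x v, w x⟫ := by
      intro x
      rw [fderiv_inner_apply ℝ ((hd1 v).differentiable one_ne_zero x)
        (hw1.differentiable one_ne_zero x), real_inner_self_eq_norm_sq]
    simp only [hpt] at h
    rw [integral_add (hi2 v) (hi1 v)] at h
    linarith
  simp only [elap, sum_inner]
  rw [integral_finsetSum _ fun i _ => hi1 _, integral_finsetSum _ fun i _ => hi2 _,
    ← Finset.sum_neg_distrib]
  exact Finset.sum_congr rfl fun i _ => key _

/-- Instantaneous energy balance for the incompressible Navier–Stokes equations, where `a` plays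
the role of the time derivative of the velocity `w`. -/
theorem integral_inner_eq_of_navierStokes {ν : ℝ} {w a g : E → E} {q : E → ℝ}
    (hw : ContDiff ℝ 2 w) (hs : HasCompactSupport w) (hq : ContDiff ℝ 1 q) (hg : Continuous g)
    (hdiv : ∀ x, ediv d w x = 0)
    (hNS : ∀ x, a x + fderiv ℝ w x (w x) = -gradient q x + ν • elap d w x + g x) :
    ∫ x, ⟪a x, w x⟫ = -ν * (∫ x, ∑ i, ∑ j, (fderiv ℝ w x (EuclideanSpace.single i 1) j) ^ 2)
      + ∫ x, ⟪g x, w x⟫ := by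
  have hw1 : ContDiff ℝ 1 w := hw.of_le one_le_two
  have hinner : ∀ b : E → E, Continuous b → Integrable fun x => ⟪b x, w x⟫ := fun b hb =>
    (hb.inner hw.continuous).integrable_of_hasCompactSupport
      (hs.mono fun x hx h => hx (by simp [h]))
  have hadv : Integrable fun x => ⟪fderiv ℝ w x (w x), w x⟫ :=
    hinner _ ((hw1.continuous_fderiv one_ne_zero).clm_apply hw.continuous)
  have hgrad : ∀ x, ⟪gradient q x, w x⟫ = fderiv ℝ q x (w x) := fun x =>
    InnerProductSpace.toDual_symm_apply
  have hpres : Integrable fun x => fderiv ℝ q x (w x) := by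
    simp only [← hgrad]
    exact hinner _ ((InnerProductSpace.toDual ℝ E).symm.continuous.comp
      (hq.continuous_fderiv one_ne_zero))
  have hlap : Integrable fun x => ⟪elap d w x, w x⟫ := by
    refine hinner _ (continuous_finsetSum _ fun i _ => ?_)
    have hd1 : ContDiff ℝ 1 fun x => fderiv ℝ w x (EuclideanSpace.single i 1) :=
      (hw.fderiv_right (m := 1) (by norm_num)).clm_apply contDiff_const
    exact (hd1.continuous_fderiv one_ne_zero).clm_apply continuous_const
  have hpt : ∀ x, ⟪a x, w x⟫ = ν * ⟪elap d w x, w x⟫ + ⟪g x, w x⟫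
      - ⟪fderiv ℝ w x (w x), w x⟫ - fderiv ℝ q x (w x) := by
    intro x
    rw [eq_sub_of_add_eq (hNS x), inner_sub_left, inner_add_left, inner_add_left, inner_neg_left,
      real_inner_smul_left, hgrad]
    ring
  simp only [hpt]
  have hsum : Integrable fun x => ν * ⟪elap d w x, w x⟫ + ⟪g x, w x⟫ :=
    (hlap.const_mul ν).add (hinner g hg)
  have hdif : Integrable fun x =>
      ν * ⟪elap d w x, w x⟫ + ⟪g x, w x⟫ - ⟪fderiv ℝ w x (w x), w x⟫ := hsum.sub hadv
  rw [integral_sub hdif hpres, integral_sub hsum hadv,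
    integral_add (hlap.const_mul ν) (hinner g hg), integral_const_mul,
    integral_inner_elap_self hw hs, integral_inner_fderiv_self_eq_zero hw1 hs hdiv,
    integral_fderiv_apply_self_eq_zero hq hw1 hs hdiv]
  ring

end Euclidean

theorem stmt_7 (d : ℕ) (hd : 1 ≤ d) (ν C : ℝ) (hν : 0 < ν) (hC : 0 ≤ C)
    (u f : ℝ → EuclideanSpace ℝ (Fin d) → EuclideanSpace ℝ (Fin d))
    (p : ℝ → EuclideanSpace ℝ (Fin d) → ℝ)
    (hu : ContDiff ℝ (⊤ : ℕ∞) (Function.uncurry u))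
    (hp : ContDiff ℝ (⊤ : ℕ∞) (Function.uncurry p))
    (hf : ContDiff ℝ (⊤ : ℕ∞) (Function.uncurry f))
    (K : Set (EuclideanSpace ℝ (Fin d))) (hK : IsCompact K)
    (hKsupp : ∀ t x, x ∉ K → u t x = 0)
    (hdiv : ∀ t x, ediv d (u t) x = 0)
    (hNS : ∀ t x, deriv (fun s => u s x) t + fderiv ℝ (u t) x (u t x)
      = -gradient (p t) x + ν • elap d (u t) x + f t x)
    (hforce : ∀ s, 0 ≤ s → 2 * ∫ x, ⟪f s x, u s x⟫ ≤ C) :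
    ∀ t, 0 ≤ t →
      (∫ x, ‖u t x‖ ^ 2)
        + 2 * ν * ∫ s in (0 : ℝ)..t,
            ∫ x, ∑ i, ∑ j, (fderiv ℝ (u s) x (EuclideanSpace.single i 1) j) ^ 2
      ≤ (∫ x, ‖u 0 x‖ ^ 2) + C * t := by
  have hcs : ∀ s, HasCompactSupport (u s) := fun s => .intro hK fun x hx => hKsupp s x hx
  have huc : Continuous (Function.uncurry u) := hu.continuous
  have hus : ∀ s, ContDiff ℝ 2 (u s) := fun s =>
    (hu.of_le (WithTop.coe_le_coe.2 le_top)).comp (contDiff_const.prodMk contDiff_id)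
  have hps : ∀ s, ContDiff ℝ 1 (p s) := fun s =>
    (hp.of_le (WithTop.coe_le_coe.2 le_top)).comp (contDiff_const.prodMk contDiff_id)
  have hfd : Continuous (fderiv ℝ (Function.uncurry u)) := hu.continuous_fderiv (by simp)
  have hdiff : Differentiable ℝ (Function.uncurry u) := hu.differentiable (by simp)
  have hux : ∀ s x v, fderiv ℝ (u s) x v = fderiv ℝ (Function.uncurry u) (s, x) (0, v) := by
    intro s x v
    have h := (hdiff (s, x)).hasFDerivAt.comp x (hasFDerivAt_prodMk_right s x)
    exact DFunLike.congr_fun h.fderiv v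
  have hut : ∀ s x, HasDerivAt (fun r => u r x)
      (fderiv ℝ (Function.uncurry u) (s, x) (1, 0)) s := by
    intro s x
    exact ((hdiff (s, x)).hasFDerivAt.comp s (hasFDerivAt_prodMk_left s x)).hasDerivAt
  set D : ℝ → ℝ := fun s =>
    ∫ x, ∑ i, ∑ j, (fderiv ℝ (u s) x (EuclideanSpace.single i 1) j) ^ 2 with hD
  set F : ℝ → ℝ := fun s => ∫ x, ⟪f s x, u s x⟫ with hF
  have hDc : Continuous D := by
    refine continuous_integral_of_support_subset hK ?_ fun s x hx => ?_
    · simp only [hux]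
      exact continuous_finsetSum _ fun i _ => continuous_finsetSum _ fun j _ =>
        ((EuclideanSpace.proj j : EuclideanSpace ℝ (Fin d) →L[ℝ] ℝ).continuous.comp
          (hfd.clm_apply continuous_const)).pow 2
    · have hsub : tsupport (u s) ⊆ K :=
        closure_minimal (fun y hy => by_contra fun hyK => hy (hKsupp s y hyK)) hK.isClosed
      simp [fderiv_of_notMem_tsupport (𝕜 := ℝ) fun h => hx (hsub h)]
  have hFc : Continuous F :=
    continuous_integral_of_support_subset hK (hf.continuous.inner huc) fun s x hx => by
      simp [hKsupp s x hx]
  have hderiv : ∀ s, HasDerivAt (fun r => ∫ x, ‖u r x‖ ^ 2) (-(2 * ν) * D s + 2 * F s) s := by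
    intro s
    have h := hasDerivAt_integral_of_support_subset hK (F := fun r x => ‖u r x‖ ^ 2)
      (F' := fun r x => 2 * ⟪u r x, fderiv ℝ (Function.uncurry u) (r, x) (1, 0)⟫)
      (continuous_pow 2 |>.comp huc.norm)
      (continuous_const.mul (huc.inner (hfd.clm_apply continuous_const)))
      (fun r x => (hut r x).norm_sq) (fun r x hx => by simp [hKsupp r x hx]) s
    convert h using 1
    have hbal := integral_inner_eq_of_navierStokes (hus s) (hcs s) (hps s)
      (hf.continuous.uncurry_left s) (hdiv s) (hNS s)
    simp only [(hut s _).deriv] at hbal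
    simp only [integral_const_mul, real_inner_comm (fderiv ℝ _ _ _), hD, hF]
    linarith
  intro t ht
  have hftc := intervalIntegral.integral_eq_sub_of_hasDerivAt (a := 0) (b := t)
    (fun s _ => hderiv s)
    ((hDc.const_mul _).add (hFc.const_mul _) |>.intervalIntegrable 0 t)
  rw [intervalIntegral.integral_add ((hDc.const_mul _).intervalIntegrable 0 t)
    ((hFc.const_mul _).intervalIntegrable 0 t), intervalIntegral.integral_const_mul] at hftc
  have hle : ∫ s in (0 : ℝ)..t, 2 * F s ≤ C * t := by
    have h := intervalIntegral.integral_mono_on ht ((hFc.const_mul 2).intervalIntegrable 0 t)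
      (continuous_const.intervalIntegrable (μ := volume) 0 t) (fun s hs => hforce s hs.1)
    simpa [mul_comm] using h
  linarith
end

section
/- Let d ≥ 1, ν > 0, T > 0, and M ≥ 0. Let u₁, u₂ : ℝ × ℝᵈ → ℝᵈ, p₁, p₂ : ℝ × ℝᵈ → ℝ, and f : ℝ × ℝᵈ → ℝᵈ be smooth, suppose there is a compact set K ⊆ ℝᵈ such that u₁(t,·) and u₂(t,·) vanish outside K for every t, suppose div u₁(t,·) = 0 and div u₂(t,·) = 0 for every t, suppose each uᵢ solves ∂ₜuᵢ + (uᵢ·∇)uᵢ = −∇pᵢ + νΔuᵢ + f, suppose the operator norm of the spatial Jacobian Dₓu₂(t,x) is bounded by M for all t ∈ [0,T] and x ∈ ℝᵈ, and suppose u₁(0,·) = u₂(0,·). Then u₁(t,·) = u₂(t,·) for all t ∈ [0,T]. -/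
open MeasureTheory RealInnerProductSpace

theorem hasDerivAt_integral_of_contDiff_of_isCompact
    {X G : Type*} [NormedAddCommGroup X] [NormedSpace ℝ X] [MeasurableSpace X] [BorelSpace X]
    [SecondCountableTopology X]
    [NormedAddCommGroup G] [NormedSpace ℝ G] {μ : Measure X} [IsFiniteMeasureOnCompacts μ]
    {F : ℝ → X → G} (hF : ContDiff ℝ 1 (Function.uncurry F)) {K : Set X} (hK : IsCompact K)
    (hFK : ∀ t, ∀ x ∉ K, F t x = 0) (t : ℝ) :
    HasDerivAt (fun s => ∫ x, F s x ∂μ) (∫ x, deriv (fun s => F s x) t ∂μ) t := by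
  have hd : ∀ s x, HasDerivAt (fun r => F r x)
      (fderiv ℝ (Function.uncurry F) (s, x) (1, 0)) s := fun s x =>
    ((hF.differentiable one_ne_zero (s, x)).hasFDerivAt.comp_hasDerivAt s
      ((hasDerivAt_id s).prodMk (hasDerivAt_const s x)) :)
  have hcont : Continuous fun z : ℝ × X => deriv (fun s => F s z.2) z.1 := by
    simp_rw [(hd _ _).deriv]
    exact (hF.continuous_fderiv one_ne_zero).clm_apply continuous_const
  have hFs : ∀ s, Continuous (F s) := fun s => hF.continuous.comp (by fun_prop : Continuous (s, ·))
  obtain ⟨C, hC⟩ := ((isCompact_closedBall t 1).prod hK).exists_bound_of_continuousOn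
    hcont.continuousOn
  refine (hasDerivAt_integral_of_dominated_loc_of_deriv_le (bound := K.indicator fun _ => C)
    (F := F) (F' := fun s x => deriv (fun r => F r x) s)
    (Metric.closedBall_mem_nhds t one_pos)
    (.of_forall fun s => (hFs s).aestronglyMeasurable)
    ((hFs t).integrable_of_hasCompactSupport (.intro hK (hFK t)))
    (hcont.comp (by fun_prop : Continuous (t, ·))).aestronglyMeasurable
    (.of_forall fun x s hs => ?_) ?_ (.of_forall fun x s _ => ?_)).2
  · by_cases hx : x ∈ K
    · simpa [hx] using hC (s, x) ⟨hs, hx⟩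
    · simp [hx, hFK]
  · exact (integrable_indicator_iff hK.measurableSet).2 (integrableOn_const hK.measure_ne_top)
  · exact (hd s x).differentiableAt.hasDerivAt

theorem integral_fderiv_apply_eq_zero_of_ediv_eq_zero {d : ℕ}
    {g : EuclideanSpace ℝ (Fin d) → ℝ} (hg : ContDiff ℝ 1 g)
    {v : EuclideanSpace ℝ (Fin d) → EuclideanSpace ℝ (Fin d)} (hv : ContDiff ℝ 1 v)
    (hvc : HasCompactSupport v) (hdiv : ∀ x, ediv d v x = 0) :
    ∫ x, fderiv ℝ g x (v x) = 0 := by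
  have hvi : ∀ i, ContDiff ℝ 1 fun x => v x i := fun _ => by fun_prop
  have hvic : ∀ i, HasCompactSupport fun x => v x i := fun i =>
    hvc.comp_left (g := fun y : EuclideanSpace ℝ (Fin d) => y i) rfl
  have hdvi : ∀ i x y, fderiv ℝ (fun x => v x i) x y = fderiv ℝ v x y i := fun i x y => by
    have h := (EuclideanSpace.proj (𝕜 := ℝ) i).hasFDerivAt.comp x
      (hv.differentiable one_ne_zero x).hasFDerivAt
    exact congrArg (· y) h.fderiv
  have hgd : ∀ y, Continuous fun x => fderiv ℝ g x y := fun y =>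
    (hg.continuous_fderiv one_ne_zero).clm_apply continuous_const
  have hvid : ∀ i y, Continuous fun x => fderiv ℝ (fun x => v x i) x y := fun i y =>
    ((hvi i).continuous_fderiv one_ne_zero).clm_apply continuous_const
  have hsplit : ∀ x, fderiv ℝ g x (v x)
      = ∑ i, fderiv ℝ g x (EuclideanSpace.single i 1) * v x i := fun x => by
    conv_lhs => rw [← (EuclideanSpace.basisFun (Fin d) ℝ).sum_repr (v x)]
    simp [mul_comm]
  have hint₁ : ∀ i, Integrable fun x => fderiv ℝ g x (EuclideanSpace.single i 1) * v x i :=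
    fun i => ((hgd _).mul (hvi i).continuous).integrable_of_hasCompactSupport (hvic i).mul_left
  have hint₂ : ∀ i, Integrable fun x =>
      g x * fderiv ℝ (fun x => v x i) x (EuclideanSpace.single i 1) := fun i =>
    (hg.continuous.mul (hvid i _)).integrable_of_hasCompactSupport
      ((hvic i).fderiv_apply ℝ _).mul_left
  have hparts : ∀ i, ∫ x, fderiv ℝ g x (EuclideanSpace.single i 1) * v x i
      = -∫ x, g x * fderiv ℝ (fun x => v x i) x (EuclideanSpace.single i 1) := fun i => by
    rw [integral_mul_fderiv_eq_neg_fderiv_mul_of_integrable (hint₁ i) (hint₂ i)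
      ((hg.continuous.mul (hvi i).continuous).integrable_of_hasCompactSupport (hvic i).mul_left)
      (fun x _ => hg.differentiable one_ne_zero x)
      (fun x _ => (hvi i).differentiable one_ne_zero x), neg_neg]
  simp_rw [hsplit]
  rw [integral_finsetSum _ fun i _ => hint₁ i]
  simp_rw [hparts]
  rw [Finset.sum_neg_distrib, ← integral_finsetSum _ fun i _ => hint₂ i]
  simp_rw [← Finset.mul_sum, hdvi]
  simp [show ∀ x, ∑ i, fderiv ℝ v x (EuclideanSpace.single i 1) i = 0 from hdiv]

theorem contDiff_fderiv_const_apply {X G : Type*} [NormedAddCommGroup X] [NormedSpace ℝ X]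
    [NormedAddCommGroup G] [NormedSpace ℝ G] {w : X → G} (hw : ContDiff ℝ 2 w) (e : X) :
    ContDiff ℝ 1 fun x => fderiv ℝ w x e :=
  (hw.fderiv_right (m := 1) (by norm_num)).clm_apply contDiff_const

theorem continuous_elap {d : ℕ} {w : EuclideanSpace ℝ (Fin d) → EuclideanSpace ℝ (Fin d)}
    (hw : ContDiff ℝ 2 w) : Continuous (elap d w) :=
  continuous_finsetSum _ fun _ _ =>
    ((contDiff_fderiv_const_apply hw _).continuous_fderiv one_ne_zero).clm_apply continuous_const

theorem integral_inner_elap_self_nonpos {d : ℕ}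
    {w : EuclideanSpace ℝ (Fin d) → EuclideanSpace ℝ (Fin d)} (hw : ContDiff ℝ 2 w)
    (hwc : HasCompactSupport w) : ∫ x, ⟪w x, elap d w x⟫ ≤ 0 := by
  have hw' := contDiff_fderiv_const_apply hw
  have hwc' : ∀ {h : EuclideanSpace ℝ (Fin d) → EuclideanSpace ℝ (Fin d)},
      HasCompactSupport h →
      ∀ k : EuclideanSpace ℝ (Fin d) → EuclideanSpace ℝ (Fin d), HasCompactSupport fun x => ⟪k x, h x⟫ := fun hh k =>
    hh.mono fun x hx hx0 => hx (by simp [hx0])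
  have hint : ∀ i, Integrable fun x => ⟪w x, fderiv ℝ (fun y => fderiv ℝ w y
      (EuclideanSpace.single i 1)) x (EuclideanSpace.single i 1)⟫ := fun _ =>
    (hw.continuous.inner (((hw' _).continuous_fderiv one_ne_zero).clm_apply
      continuous_const)).integrable_of_hasCompactSupport
      (hwc' ((hwc.fderiv_apply ℝ _).fderiv_apply ℝ _) _)
  simp_rw [elap, inner_sum]
  rw [integral_finsetSum _ fun i _ => hint i]
  refine Finset.sum_nonpos fun i _ => ?_
  have h := integral_bilinear_fderiv_right_eq_neg_left_of_integrable
    (μ := (volume : Measure (EuclideanSpace ℝ (Fin d))))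
    (B := innerSL ℝ (E := EuclideanSpace ℝ (Fin d))) (f := w)
    (g := fun y => fderiv ℝ w y (EuclideanSpace.single i 1)) (v := EuclideanSpace.single i 1)
    (((hw' _).continuous.inner (hw' _).continuous).integrable_of_hasCompactSupport
      (hwc' (hwc.fderiv_apply ℝ _) _)) (hint i)
    ((hw.continuous.inner (hw' _).continuous).integrable_of_hasCompactSupport
      (hwc' (hwc.fderiv_apply ℝ _) _))
    (fun x _ => hw.differentiable two_ne_zero x)
    (fun x _ => (hw' _).differentiable one_ne_zero x)
  exact h.trans_le (neg_nonpos.2 (integral_nonneg fun x => inner_self_nonneg (𝕜 := ℝ)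
    (x := fderiv ℝ w x (EuclideanSpace.single i 1))))

theorem elap_sub {d : ℕ} {v w : EuclideanSpace ℝ (Fin d) → EuclideanSpace ℝ (Fin d)}
    (hv : ContDiff ℝ 2 v) (hw : ContDiff ℝ 2 w) (x : EuclideanSpace ℝ (Fin d)) :
    elap d (v - w) x = elap d v x - elap d w x := by
  have h : ∀ e : EuclideanSpace ℝ (Fin d), (fun y => fderiv ℝ (v - w) y e)
      = (fun y => fderiv ℝ v y e) - fun y => fderiv ℝ w y e := fun e => by
    ext1 y
    rw [fderiv_sub (hv.differentiable two_ne_zero y) (hw.differentiable two_ne_zero y)]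
    rfl
  simp only [elap, ← Finset.sum_sub_distrib]
  refine Finset.sum_congr rfl fun i _ => ?_
  rw [h, fderiv_sub ((contDiff_fderiv_const_apply hv _).differentiable one_ne_zero x)
    ((contDiff_fderiv_const_apply hw _).differentiable one_ne_zero x)]
  rfl

theorem ediv_sub {d : ℕ} {v w : EuclideanSpace ℝ (Fin d) → EuclideanSpace ℝ (Fin d)}
    {x : EuclideanSpace ℝ (Fin d)} (hv : DifferentiableAt ℝ v x) (hw : DifferentiableAt ℝ w x) :
    ediv d (v - w) x = ediv d v x - ediv d w x := by
  simp [ediv, fderiv_sub hv hw]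

/-- The energy inequality for the difference of two solutions at a fixed time, where `a` stands for
the time derivative of the difference. -/
theorem integral_inner_le_of_difference_equation {d : ℕ} {ν M : ℝ} (hν : 0 ≤ ν)
    {u₁ u₂ a : EuclideanSpace ℝ (Fin d) → EuclideanSpace ℝ (Fin d)}
    {q : EuclideanSpace ℝ (Fin d) → ℝ}
    (hu₁ : ContDiff ℝ 2 u₁) (hu₂ : ContDiff ℝ 2 u₂) (hq : ContDiff ℝ 1 q)
    (hc₁ : HasCompactSupport u₁) (hc₂ : HasCompactSupport u₂)
    (hdiv₁ : ∀ x, ediv d u₁ x = 0) (hdiv₂ : ∀ x, ediv d u₂ x = 0)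
    (hM : ∀ x, ‖fderiv ℝ u₂ x‖ ≤ M)
    (ha : ∀ x, a x + (fderiv ℝ u₁ x (u₁ x) - fderiv ℝ u₂ x (u₂ x))
      = -gradient q x + ν • (elap d u₁ x - elap d u₂ x)) :
    ∫ x, 2 * ⟪u₁ x - u₂ x, a x⟫ ≤ 2 * M * ∫ x, ‖u₁ x - u₂ x‖ ^ 2 := by
  set w := u₁ - u₂ with hw_def
  have hw : ContDiff ℝ 2 w := hu₁.sub hu₂
  have hwc : HasCompactSupport w := hc₁.sub hc₂
  have hdivw : ∀ x, ediv d w x = 0 := fun x => by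
    rw [ediv_sub (hu₁.differentiable two_ne_zero x) (hu₂.differentiable two_ne_zero x), hdiv₁,
      hdiv₂, sub_zero]
  have hφ : ContDiff ℝ 1 fun x => ‖w x‖ ^ 2 := (hw.of_le one_le_two).norm_sq ℝ
  have hφ' : ∀ x y, fderiv ℝ (fun x => ‖w x‖ ^ 2) x y = 2 * ⟪w x, fderiv ℝ w x y⟫ :=
    fun x y => by
      rw [(hw.differentiable two_ne_zero x).hasFDerivAt.norm_sq.fderiv]
      simp
  have hpt : ∀ x, 2 * ⟪w x, a x⟫ = -fderiv ℝ (fun x => ‖w x‖ ^ 2) x (u₁ x)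
      - 2 * ⟪w x, fderiv ℝ u₂ x (w x)⟫ - 2 * fderiv ℝ q x (w x)
      + 2 * ν * ⟪w x, elap d w x⟫ := fun x => by
    have hD : fderiv ℝ w x = fderiv ℝ u₁ x - fderiv ℝ u₂ x :=
      fderiv_sub (hu₁.differentiable two_ne_zero x) (hu₂.differentiable two_ne_zero x)
    have hadv : fderiv ℝ u₁ x (u₁ x) - fderiv ℝ u₂ x (u₂ x)
        = fderiv ℝ w x (u₁ x) + fderiv ℝ u₂ x (w x) := by
      rw [hD, hw_def]
      simp
    have hgrad : ⟪w x, gradient q x⟫ = fderiv ℝ q x (w x) := by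
      rw [real_inner_comm, gradient, InnerProductSpace.toDual_symm_apply]
    have hax := ha x
    rw [hadv, ← elap_sub hu₁ hu₂, ← hw_def] at hax
    rw [eq_sub_of_add_eq hax, hφ', inner_sub_right, inner_add_right, inner_add_right,
      inner_neg_right, real_inner_smul_right, hgrad]
    ring
  have hle : ∀ x, 2 * ⟪w x, a x⟫ ≤ -fderiv ℝ (fun x => ‖w x‖ ^ 2) x (u₁ x)
      + 2 * M * ‖w x‖ ^ 2 - 2 * fderiv ℝ q x (w x) + 2 * ν * ⟪w x, elap d w x⟫ := fun x => by
    have h₁ := neg_le_of_abs_le (abs_real_inner_le_norm (w x) (fderiv ℝ u₂ x (w x)))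
    have h₂ : ‖w x‖ * ‖fderiv ℝ u₂ x (w x)‖ ≤ ‖w x‖ * (M * ‖w x‖) := by
      gcongr
      exact (fderiv ℝ u₂ x).le_of_opNorm_le (hM x) _
    rw [hpt]
    nlinarith
  have hi₁ : Integrable fun x => fderiv ℝ (fun x => ‖w x‖ ^ 2) x (u₁ x) :=
    ((hφ.continuous_fderiv one_ne_zero).clm_apply hu₁.continuous).integrable_of_hasCompactSupport
      (hc₁.mono fun x hx hx0 => hx (by simp [hx0]))
  have hi₂ : Integrable fun x => ‖w x‖ ^ 2 :=
    hφ.continuous.integrable_of_hasCompactSupport (hwc.mono fun x hx hx0 => hx (by simp [hx0]))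
  have hi₃ : Integrable fun x => fderiv ℝ q x (w x) :=
    ((hq.continuous_fderiv one_ne_zero).clm_apply hw.continuous).integrable_of_hasCompactSupport
      (hwc.mono fun x hx hx0 => hx (by simp [hx0]))
  have hi₄ : Integrable fun x => ⟪w x, elap d w x⟫ :=
    (hw.continuous.inner (continuous_elap hw)).integrable_of_hasCompactSupport
      (hwc.mono fun x hx hx0 => hx (by simp [hx0]))
  have hi₅ : Integrable fun x => ⟪w x, fderiv ℝ u₂ x (w x)⟫ :=
    (hw.continuous.inner ((hu₂.continuous_fderiv two_ne_zero).clm_apply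
      hw.continuous)).integrable_of_hasCompactSupport
      (hwc.mono fun x hx hx0 => hx (by simp [hx0]))
  have hi₆ : Integrable fun x => -fderiv ℝ (fun x => ‖w x‖ ^ 2) x (u₁ x) + 2 * M * ‖w x‖ ^ 2 :=
    hi₁.neg.add (hi₂.const_mul _)
  have hi₇ : Integrable fun x => -fderiv ℝ (fun x => ‖w x‖ ^ 2) x (u₁ x) + 2 * M * ‖w x‖ ^ 2
      - 2 * fderiv ℝ q x (w x) := hi₆.sub (hi₃.const_mul _)
  calc ∫ x, 2 * ⟪w x, a x⟫
      ≤ ∫ x, (-fderiv ℝ (fun x => ‖w x‖ ^ 2) x (u₁ x) + 2 * M * ‖w x‖ ^ 2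
          - 2 * fderiv ℝ q x (w x) + 2 * ν * ⟪w x, elap d w x⟫) := by
        refine integral_mono ?_ (hi₇.add (hi₄.const_mul _)) hle
        simp_rw [hpt]
        exact ((hi₁.neg.sub (hi₅.const_mul _)).sub (hi₃.const_mul _)).add (hi₄.const_mul _)
    _ = 2 * M * (∫ x, ‖w x‖ ^ 2) + 2 * ν * ∫ x, ⟪w x, elap d w x⟫ := by
        rw [integral_add hi₇ (hi₄.const_mul _), integral_sub hi₆ (hi₃.const_mul _),
          integral_add hi₁.fun_neg (hi₂.const_mul _), integral_neg, integral_const_mul,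
          integral_const_mul, integral_const_mul,
          integral_fderiv_apply_eq_zero_of_ediv_eq_zero hφ (hu₁.of_le one_le_two) hc₁ hdiv₁,
          integral_fderiv_apply_eq_zero_of_ediv_eq_zero hq (hw.of_le one_le_two) hwc hdivw]
        ring
    _ ≤ 2 * M * ∫ x, ‖w x‖ ^ 2 := by
        have := mul_nonneg hν (neg_nonneg.2 (integral_inner_elap_self_nonpos hw hwc))
        linarith

theorem stmt_8 (d : ℕ) (hd : 1 ≤ d) (ν T M : ℝ) (hν : 0 < ν) (hT : 0 < T) (hM : 0 ≤ M)
    (u₁ u₂ f : ℝ → EuclideanSpace ℝ (Fin d) → EuclideanSpace ℝ (Fin d))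
    (p₁ p₂ : ℝ → EuclideanSpace ℝ (Fin d) → ℝ)
    (hu₁ : ContDiff ℝ (⊤ : ℕ∞) (Function.uncurry u₁))
    (hu₂ : ContDiff ℝ (⊤ : ℕ∞) (Function.uncurry u₂))
    (hp₁ : ContDiff ℝ (⊤ : ℕ∞) (Function.uncurry p₁))
    (hp₂ : ContDiff ℝ (⊤ : ℕ∞) (Function.uncurry p₂))
    (hf : ContDiff ℝ (⊤ : ℕ∞) (Function.uncurry f))
    (K : Set (EuclideanSpace ℝ (Fin d))) (hK : IsCompact K)
    (hKsupp : ∀ t x, x ∉ K → u₁ t x = 0 ∧ u₂ t x = 0)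
    (hdiv₁ : ∀ t x, ediv d (u₁ t) x = 0)
    (hdiv₂ : ∀ t x, ediv d (u₂ t) x = 0)
    (hNS₁ : ∀ t x, deriv (fun s => u₁ s x) t + fderiv ℝ (u₁ t) x (u₁ t x)
      = -gradient (p₁ t) x + ν • elap d (u₁ t) x + f t x)
    (hNS₂ : ∀ t x, deriv (fun s => u₂ s x) t + fderiv ℝ (u₂ t) x (u₂ t x)
      = -gradient (p₂ t) x + ν • elap d (u₂ t) x + f t x)
    (hjac : ∀ t ∈ Set.Icc (0 : ℝ) T, ∀ x, ‖fderiv ℝ (u₂ t) x‖ ≤ M)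
    (h0 : u₁ 0 = u₂ 0) :
    ∀ t ∈ Set.Icc (0 : ℝ) T, u₁ t = u₂ t := by
  intro t ht
  have hslice : ∀ {G : Type} [NormedAddCommGroup G] [NormedSpace ℝ G]
      {h : ℝ → EuclideanSpace ℝ (Fin d) → G}, ContDiff ℝ (⊤ : ℕ∞) (Function.uncurry h) →
      ∀ s, ContDiff ℝ (⊤ : ℕ∞) (h s) := fun hh s => hh.comp (contDiff_prodMk_right s)
  have htime : ∀ {h : ℝ → EuclideanSpace ℝ (Fin d) → EuclideanSpace ℝ (Fin d)},
      ContDiff ℝ (⊤ : ℕ∞) (Function.uncurry h) → ∀ s x, DifferentiableAt ℝ (fun r => h r x) s :=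
    fun hh s x => ((hh.comp (contDiff_prodMk_left x)).differentiable (by simp) s :)
  have hc₁ : ∀ s, HasCompactSupport (u₁ s) := fun s => .intro hK fun x hx => (hKsupp s x hx).1
  have hc₂ : ∀ s, HasCompactSupport (u₂ s) := fun s => .intro hK fun x hx => (hKsupp s x hx).2
  have hE : ∀ s, HasDerivAt (fun s => ∫ x, ‖u₁ s x - u₂ s x‖ ^ 2)
      (∫ x, 2 * ⟪u₁ s x - u₂ s x, deriv (fun r => u₁ r x) s - deriv (fun r => u₂ r x) s⟫) s :=
    fun s => by
      have h := hasDerivAt_integral_of_contDiff_of_isCompact (μ := volume)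
        (F := fun s x => ‖u₁ s x - u₂ s x‖ ^ 2)
        (((hu₁.sub hu₂).norm_sq ℝ).of_le (by exact_mod_cast le_top)) hK
        (fun s x hx => by simp [hKsupp s x hx]) s
      refine h.congr_deriv (integral_congr_ae (.of_forall fun x => ?_))
      exact ((htime hu₁ s x).hasDerivAt.sub (htime hu₂ s x).hasDerivAt).norm_sq.deriv
  have hbound : ∀ s ∈ Set.Ico 0 T,
      (∫ x, 2 * ⟪u₁ s x - u₂ s x, deriv (fun r => u₁ r x) s - deriv (fun r => u₂ r x) s⟫)
        ≤ 2 * M * (∫ x, ‖u₁ s x - u₂ s x‖ ^ 2) + 0 := fun s hs => by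
    rw [add_zero]
    have hp₁' := hslice hp₁ s
    have hp₂' := hslice hp₂ s
    refine integral_inner_le_of_difference_equation (q := p₁ s - p₂ s) hν.le
      (contDiff_infty.1 (hslice hu₁ s) 2)
      (contDiff_infty.1 (hslice hu₂ s) 2)
      ((hp₁'.sub hp₂').of_le (by exact_mod_cast le_top)) (hc₁ s) (hc₂ s) (hdiv₁ s)
      (hdiv₂ s) (hjac s ⟨hs.1, hs.2.le⟩) fun x => ?_
    have hgrad : gradient (p₁ s - p₂ s) x = gradient (p₁ s) x - gradient (p₂ s) x := by
      rw [gradient, fderiv_sub (hp₁'.differentiable (by simp) x)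
        (hp₂'.differentiable (by simp) x), map_sub]
      rfl
    rw [hgrad, add_sub_assoc', sub_add_eq_add_sub, hNS₁, sub_sub, hNS₂]
    module
  have hzero : ∫ x, ‖u₁ t x - u₂ t x‖ ^ 2 = 0 := by
    refine le_antisymm ?_ (integral_nonneg fun x => by positivity)
    have h := le_gronwallBound_of_liminf_deriv_right_le (δ := 0) (a := 0) (b := T)
      (fun s _ => (hE s).continuousAt.continuousWithinAt)
      (fun s _ r hr => (hE s).hasDerivWithinAt.liminf_right_slope_le hr) (by simp [h0]) hbound t ht
    simpa [gronwallBound_ε0_δ0] using h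
  have hw : Continuous fun x => ‖u₁ t x - u₂ t x‖ ^ 2 :=
    ((hslice hu₁ t).continuous.sub (hslice hu₂ t).continuous).norm.pow 2
  have hwc : HasCompactSupport fun x => ‖u₁ t x - u₂ t x‖ ^ 2 :=
    .intro hK fun x hx => by simp [hKsupp t x hx]
  have hae := (integral_eq_zero_iff_of_nonneg (fun x => by positivity)
    (hw.integrable_of_hasCompactSupport hwc)).1 hzero
  have hall := (hw.ae_eq_iff_eq volume (continuous_const (y := (0 : ℝ)))).1 hae
  ext1 x
  simpa [sub_eq_zero] using congrFun hall x
end
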